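/- (One-step duality for geometric q-TASEP.) Fix q ∈ (0,1), N ≥ 1, parameters a_1,…,a_N > 0 and α ∈ (0,1) with a_i α < 1 for all i. Let x⃗ = (x_1 > x_2 > ⋯ > x_N) ∈ ℤ^N and set gap_i = x_{i−1} − x_i − 1 for 2 ≤ i ≤ N. Then for every y⃗ ∈ Y^N the following absolutely convergent sum over integer vectors j⃗ = (j_1,…,j_N) with j_1 ≥ 0 and 0 ≤ j_i ≤ gap_i (2 ≤ i ≤ N) satisfies: ∑_{j⃗} [ p_{∞, a_1 α}(j_1) ∏_{i=2}^{N} p_{gap_i, a_i α}(j_i) ] H_{x⃗+j⃗}(y⃗) = (A^{(−a_1 α)}_1 A^{(−a_2 α)}_2 ⋯ A^{(−a_N α)}_N H_{x⃗})(y⃗), where the operators are composed with A^{(−a_N α)}_N applied first. -/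

import Mathlib

/-- The q-Pochhammer symbol `(a;q)_n = ∏_{i=0}^{n-1} (1 - a q^i)`. -/
noncomputable def qPoch (q a : ℝ) (n : ℕ) : ℝ := ∏ i ∈ Finset.range n, (1 - a * q ^ i)

/-- The infinite q-Pochhammer symbol `(a;q)_∞ = ∏_{i=0}^{∞} (1 - a q^i)`. -/
noncomputable def qPochInf (q a : ℝ) : ℝ := ∏' i : ℕ, (1 - a * q ^ i)

/-- `p_{m,α}(j) = α^j (α;q)_{m-j} (q;q)_m / ((q;q)_{m-j} (q;q)_j)` for `0 ≤ j ≤ m`, else `0`. -/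
noncomputable def pgeo (q α : ℝ) (m : ℕ) (j : ℤ) : ℝ :=
  if 0 ≤ j ∧ j ≤ (m : ℤ) then
    α ^ j.toNat * qPoch q α (m - j.toNat) *
      (qPoch q q m / (qPoch q q (m - j.toNat) * qPoch q q j.toNat))
  else 0

/-- `p_{∞,α}(j) = α^j (α;q)_∞ / (q;q)_j` for `j ≥ 0`. -/
noncomputable def pInf (q α : ℝ) (j : ℕ) : ℝ := α ^ j * qPochInf q α / qPoch q q j

/-- The coefficients `C_a(y,s)`, with the convention `C_a(y,s) = 0` for `s < 0` or `s > y`. -/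
noncomputable def Cco (q a : ℝ) (y : ℕ) (s : ℤ) : ℝ :=
  if 0 ≤ s ∧ s ≤ (y : ℤ) then
    (-a) ^ s.toNat * qPoch q (-a) (y - s.toNat) *
      (qPoch q q y / (qPoch q q (y - s.toNat) * qPoch q q s.toNat))
  else 0

/-- `y⃗^{s}_{i,i-1}`: move `s` units of mass from coordinate `i+1` (paper index `i+1 ∈ {1,…,N}`)
to coordinate `i` of `y⃗ ∈ Y^N = ℤ_{≥0}^{N+1}`.  Here `i : Fin N` denotes paper index `i+1`. -/
def moveY {N : ℕ} (y : Fin (N + 1) → ℕ) (i : Fin N) (s : ℕ) : Fin (N + 1) → ℕ :=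
  Function.update (Function.update y i.succ (y i.succ - s)) i.castSucc (y i.castSucc + s)

/-- The operator `(A^{(a)}_i f)(y⃗) = ∑_{s=0}^{y_i} C_a(y_i,s) f(y⃗^{s}_{i,i-1})`,
where `i : Fin N` denotes paper index `i+1`. -/
noncomputable def Aop {N : ℕ} (q a : ℝ) (i : Fin N) (f : (Fin (N + 1) → ℕ) → ℝ)
    (y : Fin (N + 1) → ℕ) : ℝ :=
  ∑ s ∈ Finset.range (y i.succ + 1), Cco q a (y i.succ) (s : ℤ) * f (moveY y i s)

/-- The composition `A^{(c_1)}_1 ⋯ A^{(c_N)}_N f`, with the operator of index `N` applied first. -/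
noncomputable def Acomp {N : ℕ} (q : ℝ) (c : Fin N → ℝ) (f : (Fin (N + 1) → ℕ) → ℝ) :
    (Fin (N + 1) → ℕ) → ℝ :=
  (List.finRange N).foldr (fun i g => Aop q (c i) i g) f

/-- `H_{x⃗}(y⃗) = ∏_{i=1}^{N} q^{(x_i+i) y_i}` if `y_0 = 0`, and `0` if `y_0 > 0`. -/
noncomputable def Hfun {N : ℕ} (q : ℝ) (x : Fin N → ℤ) (y : Fin (N + 1) → ℕ) : ℝ :=
  if y 0 = 0 then ∏ i : Fin N, q ^ ((x i + (i : ℕ) + 1) * (y i.succ : ℤ)) else 0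

/-- Predecessor index in `Fin N` (truncated at `0`). -/
def predF {N : ℕ} (i : Fin N) : Fin N := ⟨(i : ℕ) - 1, Nat.lt_of_le_of_lt (Nat.sub_le _ _) i.isLt⟩

lemma qPoch_succ (q a : ℝ) (n : ℕ) : qPoch q a (n + 1) = qPoch q a n * (1 - a * q ^ n) :=
  Finset.prod_range_succ _ _

lemma qPoch_zero (q a : ℝ) : qPoch q a 0 = 1 := Finset.prod_range_zero _

lemma one_sub_pow_succ_pos {q : ℝ} (hq : q ∈ Set.Ioo (0 : ℝ) 1) (n : ℕ) : 0 < 1 - q * q ^ n := by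
  have := pow_lt_one₀ hq.1.le hq.2 n.succ_ne_zero
  rw [pow_succ'] at this
  linarith

lemma qPoch_self_pos {q : ℝ} (hq : q ∈ Set.Ioo (0 : ℝ) 1) (n : ℕ) : 0 < qPoch q q n :=
  Finset.prod_pos fun i _ => one_sub_pow_succ_pos hq i

lemma pgeo_of_le (q β : ℝ) {m j : ℕ} (h : j ≤ m) :
    pgeo q β m (j : ℤ) = β ^ j * qPoch q β (m - j) *
      (qPoch q q m / (qPoch q q (m - j) * qPoch q q j)) := by
  simp [pgeo, h]

lemma pgeo_of_lt (q β : ℝ) {m j : ℕ} (h : m < j) : pgeo q β m (j : ℤ) = 0 := by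
  simp [pgeo, h]

lemma Cco_neg (q β : ℝ) (y : ℕ) (s : ℤ) : Cco q (-β) y s = pgeo q β y s := by
  simp [Cco, pgeo]

lemma pgeo_zero_right {q : ℝ} (hq : q ∈ Set.Ioo (0 : ℝ) 1) (β : ℝ) (m : ℕ) :
    pgeo q β m ((0 : ℕ) : ℤ) = qPoch q β m := by
  rw [pgeo_of_le _ _ m.zero_le]
  have := (qPoch_self_pos hq m).ne'
  simp [qPoch_zero, this]

lemma pgeo_succ_succ {q : ℝ} (hq : q ∈ Set.Ioo (0 : ℝ) 1) (β : ℝ) (m j : ℕ) :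
    pgeo q β (m + 1) ((j + 1 : ℕ) : ℤ) =
      (q ^ (j + 1) - β * q ^ m) * pgeo q β m ((j + 1 : ℕ) : ℤ) + β * pgeo q β m (j : ℤ) := by
  have hj := (qPoch_self_pos hq j).ne'
  have hj' := (one_sub_pow_succ_pos hq j).ne'
  rcases lt_trichotomy j m with h | h | h
  · obtain ⟨d, rfl⟩ := Nat.exists_eq_add_of_le (Nat.succ_le_of_lt h)
    rw [pgeo_of_le _ _ (by omega), pgeo_of_le _ _ (by omega), pgeo_of_le _ _ (by omega)]
    rw [show j.succ + d + 1 - (j + 1) = d + 1 by omega, show j.succ + d - (j + 1) = d by omega,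
      show j.succ + d - j = d + 1 by omega]
    have hd := (qPoch_self_pos hq d).ne'
    have hd' := (one_sub_pow_succ_pos hq d).ne'
    simp only [qPoch_succ, Nat.succ_eq_add_one, pow_add, pow_one]
    generalize q ^ j = A at *
    generalize q ^ d = B at *
    have hd'' : 1 - B * q ≠ 0 := by rwa [mul_comm]
    field_simp
    ring
  · subst h
    rw [pgeo_of_le _ _ le_rfl, pgeo_of_le _ _ le_rfl, pgeo_of_lt _ _ (Nat.lt_succ_self _)]
    have hs := (qPoch_self_pos hq (j + 1)).ne'
    simp only [Nat.sub_self, qPoch_zero]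
    field_simp
    ring
  · rw [pgeo_of_lt _ _ (by omega), pgeo_of_lt _ _ (by omega), pgeo_of_lt _ _ h]
    ring

/-- The generating polynomial `∑_j p_{m,β}(j) z^j`. -/
noncomputable def pgeoGen (q β : ℝ) (m : ℕ) (z : ℝ) : ℝ :=
  ∑ j ∈ Finset.range (m + 1), pgeo q β m (j : ℤ) * z ^ j

lemma pgeoGen_succ {q : ℝ} (hq : q ∈ Set.Ioo (0 : ℝ) 1) (β : ℝ) (m : ℕ) (z : ℝ) :
    pgeoGen q β (m + 1) z = pgeoGen q β m (q * z) + β * (z - q ^ m) * pgeoGen q β m z := by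
  have ext (w : ℝ) : pgeoGen q β m w = pgeo q β m ((0 : ℕ) : ℤ) +
      ∑ j ∈ Finset.range (m + 1), pgeo q β m ((j + 1 : ℕ) : ℤ) * w ^ (j + 1) := by
    have : pgeoGen q β m w = ∑ j ∈ Finset.range (m + 2), pgeo q β m (j : ℤ) * w ^ j := by
      rw [Finset.sum_range_succ, pgeo_of_lt q β (Nat.lt_succ_self m)]
      simp [pgeoGen]
    rw [this, Finset.sum_range_succ']
    simp [add_comm]
  have key : pgeoGen q β (m + 1) z = pgeo q β (m + 1) ((0 : ℕ) : ℤ) +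
      ((∑ j ∈ Finset.range (m + 1), pgeo q β m ((j + 1 : ℕ) : ℤ) * (q * z) ^ (j + 1)) -
      β * q ^ m * (∑ j ∈ Finset.range (m + 1), pgeo q β m ((j + 1 : ℕ) : ℤ) * z ^ (j + 1)) +
      β * z * pgeoGen q β m z) := by
    rw [pgeoGen, Finset.sum_range_succ', add_comm, pgeoGen]
    simp only [Finset.mul_sum, ← Finset.sum_sub_distrib, ← Finset.sum_add_distrib]
    congr 1
    · simp
    · refine Finset.sum_congr rfl fun j _ => ?_
      rw [pgeo_succ_succ hq]
      ring
  have h0 : pgeo q β (m + 1) ((0 : ℕ) : ℤ) = (1 - β * q ^ m) * pgeo q β m ((0 : ℕ) : ℤ) := by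
    rw [pgeo_zero_right hq, pgeo_zero_right hq, qPoch_succ]
    ring
  rw [key, h0, mul_sub, sub_mul, ext (q * z)]
  linear_combination (β * q ^ m) * ext z

/-- The self-duality of the `q`-geometric weights. -/
lemma pgeoGen_symm {q : ℝ} (hq : q ∈ Set.Ioo (0 : ℝ) 1) (β : ℝ) (m y : ℕ) :
    pgeoGen q β m (q ^ y) = pgeoGen q β y (q ^ m) := by
  suffices h : ∀ n m y, m + y = n → pgeoGen q β m (q ^ y) = pgeoGen q β y (q ^ m) from h _ _ _ rfl
  intro n
  induction n with
  | zero =>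
    intro m y h
    obtain ⟨rfl, rfl⟩ : m = 0 ∧ y = 0 := by omega
    rfl
  | succ n ih =>
    have step (m y : ℕ) (h : m + y = n) :
        pgeoGen q β (m + 1) (q ^ y) - pgeoGen q β y (q ^ (m + 1)) =
        pgeoGen q β m (q ^ (y + 1)) - pgeoGen q β (y + 1) (q ^ m) := by
      rw [pgeoGen_succ hq, pgeoGen_succ hq, ← pow_succ', ← pow_succ', ih m y h]
      ring
    have const (m : ℕ) : ∀ y, m + y = n + 1 → pgeoGen q β m (q ^ y) - pgeoGen q β y (q ^ m) =
        pgeoGen q β 0 (q ^ (n + 1)) - pgeoGen q β (n + 1) (q ^ 0) := by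
      induction m with
      | zero =>
        intro y h
        obtain rfl : y = n + 1 := by omega
        rfl
      | succ m ihm =>
        intro y h
        rw [step m y (by omega), ihm (y + 1) (by omega)]
    intro m y h
    have h1 := const (n + 1) 0 rfl
    have h2 := const m y h
    linarith

lemma hasSum_pgeo (q β : ℝ) (m : ℕ) (z : ℝ) :
    HasSum (fun j : ℕ => pgeo q β m (j : ℤ) * z ^ j) (pgeoGen q β m z) := by
  refine hasSum_sum_of_ne_finset_zero fun j hj => ?_
  rw [Finset.mem_range, not_lt] at hj
  rw [pgeo_of_lt q β hj, zero_mul]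

lemma summable_pow_div_qPoch {q : ℝ} (hq : q ∈ Set.Ioo (0 : ℝ) 1) {z : ℝ} (hz : 0 < z)
    (hz1 : z < 1) : Summable fun j : ℕ => z ^ j / qPoch q q j := by
  have hpos (j : ℕ) : 0 < z ^ j / qPoch q q j := div_pos (pow_pos hz j) (qPoch_self_pos hq j)
  refine summable_of_ratio_test_tendsto_lt_one hz1 (.of_forall fun j => (hpos j).ne') ?_
  have h : Filter.Tendsto (fun j : ℕ => z / (1 - q * q ^ j)) Filter.atTop (nhds (z / (1 - q * 0))) :=
    tendsto_const_nhds.div (tendsto_const_nhds.sub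
      ((tendsto_pow_atTop_nhds_zero_of_lt_one hq.1.le hq.2).const_mul q)) (by simp)
  simp only [mul_zero, sub_zero, div_one] at h
  refine h.congr fun j => ?_
  rw [Real.norm_of_nonneg (hpos _).le, Real.norm_of_nonneg (hpos _).le, qPoch_succ]
  have := (qPoch_self_pos hq j).ne'
  have := (one_sub_pow_succ_pos hq j).ne'
  field_simp
  ring

lemma one_sub_mul_tsum_pow_div_qPoch {q : ℝ} (hq : q ∈ Set.Ioo (0 : ℝ) 1) {z : ℝ} (hz : 0 < z)
    (hz1 : z < 1) :
    ∑' j : ℕ, (q * z) ^ j / qPoch q q j = (1 - z) * ∑' j : ℕ, z ^ j / qPoch q q j := by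
  have hs := summable_pow_div_qPoch hq hz hz1
  have hs' := summable_pow_div_qPoch hq (mul_pos hq.1 hz)
    (mul_lt_one_of_nonneg_of_lt_one_left hq.1.le hq.2 hz1.le)
  have h : ∑' j : ℕ, (z ^ j / qPoch q q j - (q * z) ^ j / qPoch q q j) =
      z * ∑' j : ℕ, z ^ j / qPoch q q j := by
    rw [(hs.sub hs').tsum_eq_zero_add, ← tsum_mul_left]
    simp only [pow_zero, sub_self, zero_add]
    refine tsum_congr fun j => ?_
    rw [qPoch_succ]
    have := (qPoch_self_pos hq j).ne'
    have := (one_sub_pow_succ_pos hq j).ne'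
    field_simp
    ring
  rw [hs.tsum_sub hs'] at h
  linarith

lemma tsum_pow_mul_div_qPoch {q : ℝ} (hq : q ∈ Set.Ioo (0 : ℝ) 1) {z : ℝ} (hz : 0 < z)
    (hz1 : z < 1) (n : ℕ) :
    ∑' j : ℕ, (z * q ^ n) ^ j / qPoch q q j = qPoch q z n * ∑' j : ℕ, z ^ j / qPoch q q j := by
  induction n with
  | zero => simp [qPoch_zero]
  | succ n ih =>
    have h1 : z * q ^ n < 1 :=
      mul_lt_one_of_nonneg_of_lt_one_left hz.le hz1 (pow_le_one₀ hq.1.le hq.2.le)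
    rw [show z * q ^ (n + 1) = q * (z * q ^ n) by ring,
      one_sub_mul_tsum_pow_div_qPoch hq (mul_pos hz (pow_pos hq.1 n)) h1, ih, qPoch_succ]
    ring

lemma tendsto_qPoch {q : ℝ} (hq : q ∈ Set.Ioo (0 : ℝ) 1) (z : ℝ) :
    Filter.Tendsto (qPoch q z) Filter.atTop (nhds (qPochInf q z)) := by
  have h : Multipliable fun i : ℕ => 1 + (-(z * q ^ i)) := by
    apply Real.multipliable_one_add_of_summable
    exact ((summable_geometric_of_lt_one hq.1.le hq.2).mul_left z).neg
  have ht := h.hasProd.tendsto_prod_nat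
  simp only [← sub_eq_add_neg] at ht
  exact ht

/-- Euler's identity `∑_j z^j / (q;q)_j = 1 / (z;q)_∞`. -/
lemma qPochInf_mul_tsum {q : ℝ} (hq : q ∈ Set.Ioo (0 : ℝ) 1) {z : ℝ} (hz : 0 < z) (hz1 : z < 1) :
    qPochInf q z * ∑' j : ℕ, z ^ j / qPoch q q j = 1 := by
  have h1 := (tendsto_qPoch hq z).mul_const (∑' j : ℕ, z ^ j / qPoch q q j)
  simp only [← tsum_pow_mul_div_qPoch hq hz hz1] at h1
  refine tendsto_nhds_unique h1 ?_
  have h2 : Filter.Tendsto (fun n : ℕ => ∑' j : ℕ, (z * q ^ n) ^ j / qPoch q q j) Filter.atTop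
      (nhds (∑' j : ℕ, (z * 0) ^ j / qPoch q q j)) := by
    refine tendsto_tsum_of_dominated_convergence (summable_pow_div_qPoch hq hz hz1)
      (fun j => (((tendsto_pow_atTop_nhds_zero_of_lt_one hq.1.le hq.2).const_mul z).pow j).div_const
        _) (.of_forall fun n j => ?_)
    have hp := pow_pos hq.1 n
    have := qPoch_self_pos hq j
    rw [Real.norm_of_nonneg (by positivity)]
    gcongr
    exact mul_le_of_le_one_right hz.le (pow_le_one₀ hq.1.le hq.2.le)
  have h3 : ∑' j : ℕ, (z * 0) ^ j / qPoch q q j = 1 := by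
    rw [tsum_eq_single 0 fun j hj => by simp [hj]]
    simp [qPoch_zero]
  rwa [h3] at h2

lemma hasSum_pInf {q : ℝ} (hq : q ∈ Set.Ioo (0 : ℝ) 1) {β : ℝ} (hβ : 0 < β) (hβ1 : β < 1) (y : ℕ) :
    HasSum (fun j : ℕ => pInf q β j * (q ^ y) ^ j) (qPoch q β y) := by
  have h1 : β * q ^ y < 1 :=
    mul_lt_one_of_nonneg_of_lt_one_left hβ.le hβ1 (pow_le_one₀ hq.1.le hq.2.le)
  have h := (summable_pow_div_qPoch hq (mul_pos hβ (pow_pos hq.1 y)) h1).hasSum.mul_left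
    (qPochInf q β)
  rw [tsum_pow_mul_div_qPoch hq hβ hβ1, mul_left_comm, qPochInf_mul_tsum hq hβ hβ1, mul_one] at h
  refine h.congr_fun fun j => ?_
  rw [pInf, mul_pow]
  ring

lemma hasSum_mul_prod {ι κ : Type*} {f : ι → ℝ} {g : κ → ℝ} {b c : ℝ} (hf : HasSum f b)
    (hg : HasSum g c) : HasSum (fun p : ι × κ => f p.1 * g p.2) (b * c) :=
  hf.mul hg (summable_mul_of_summable_norm (summable_norm_iff.2 hf.summable)
    (summable_norm_iff.2 hg.summable))

lemma hasSum_prod_fin {N : ℕ} (f : Fin N → ℕ → ℝ) (c : Fin N → ℝ)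
    (h : ∀ i, HasSum (f i) (c i)) : HasSum (fun j : Fin N → ℕ => ∏ i, f i (j i)) (∏ i, c i) := by
  induction N with
  | zero => simp
  | succ N ih =>
    have ht := ih (fun i => f i.succ) (fun i => c i.succ) fun i => h i.succ
    have hm := hasSum_mul_prod (h 0) ht
    rw [Fin.prod_univ_succ, ← (Fin.consEquiv fun _ : Fin (N + 1) => ℕ).hasSum_iff]
    refine hm.congr_fun fun p => ?_
    simp [Fin.prod_univ_succ, Fin.consEquiv]

/-- The factor by which moving `s` units from site `i + 1` to site `i` multiplies `Hfun q x`. -/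
noncomputable def moveWeight {N : ℕ} (q : ℝ) (x : Fin N → ℤ) (i : Fin N) (s : ℕ) : ℝ :=
  if (i : ℕ) = 0 then (if s = 0 then 1 else 0) else (q ^ (x (predF i) - x i - 1).toNat) ^ s

lemma Hfun_moveY {q : ℝ} (hq : q ≠ 0) {N : ℕ} {x : Fin N → ℤ} (hx : StrictAnti x)
    (y : Fin (N + 1) → ℕ) (i : Fin N) {s : ℕ} (hs : s ≤ y i.succ) :
    Hfun q x (moveY y i s) = Hfun q x y * moveWeight q x i s := by
  by_cases hi : (i : ℕ) = 0
  · have hc : i.castSucc = 0 := Fin.ext hi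
    rcases Nat.eq_zero_or_pos s with rfl | hpos
    · simp [moveY, moveWeight]
    · simp [moveY, moveWeight, Hfun, hi, hc, hpos.ne']
  · have hp : (predF i).succ = i.castSucc := Fin.ext (by simp [predF]; omega)
    have hlt : predF i < i := Fin.lt_def.2 (by simp [predF]; omega)
    have h0 : moveY y i s 0 = y 0 := by
      rw [moveY, Function.update_of_ne, Function.update_of_ne]
      · exact (Fin.succ_ne_zero i).symm
      · exact fun h => hi (congrArg Fin.val h).symm
    have hne : i.succ ≠ i.castSucc := (Fin.castSucc_lt_succ (i := i)).ne'
    have hk (k : Fin N) : q ^ ((x k + (k : ℕ) + 1) * (moveY y i s k.succ : ℤ)) =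
        q ^ ((x k + (k : ℕ) + 1) * (y k.succ : ℤ)) *
        ((if k = predF i then q ^ ((x k + (k : ℕ) + 1) * (s : ℤ)) else 1) *
         (if k = i then q ^ (-((x k + (k : ℕ) + 1) * (s : ℤ))) else 1)) := by
      by_cases h1 : k = predF i
      · subst h1
        rw [if_pos rfl, if_neg hlt.ne, moveY, hp, Function.update_self, mul_one, ← zpow_add₀ hq]
        congr 1
        push_cast
        ring
      · have h1' : k.succ ≠ i.castSucc := by
          rw [← hp]
          exact fun h => h1 (Fin.succ_injective _ h)
        rw [if_neg h1, moveY, Function.update_of_ne h1', one_mul]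
        by_cases h2 : k = i
        · subst h2
          rw [if_pos rfl, Function.update_self, ← zpow_add₀ hq]
          congr 1
          push_cast [hs]
          ring
        · rw [if_neg h2, Function.update_of_ne fun h => h2 (Fin.succ_injective _ h), mul_one]
    rw [Hfun, Hfun, h0]
    split_ifs with hy
    · rw [Finset.prod_congr rfl fun k _ => hk k, Finset.prod_mul_distrib, Finset.prod_mul_distrib,
        Finset.prod_ite_eq' , Finset.prod_ite_eq', if_pos (Finset.mem_univ _),
        if_pos (Finset.mem_univ _), moveWeight, if_neg hi, ← zpow_add₀ hq, ← pow_mul,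
        ← zpow_natCast]
      congr 2
      have hg : 0 ≤ x (predF i) - x i - 1 := by have := hx hlt; omega
      have hv : ((predF i : ℕ) : ℤ) = (i : ℕ) - 1 := by simp [predF]; omega
      rw [Nat.cast_mul, Int.toNat_of_nonneg hg, hv]
      ring
    · rw [zero_mul]

lemma foldr_Aop_Hfun {q : ℝ} (hq : q ≠ 0) {N : ℕ} {x : Fin N → ℤ} (hx : StrictAnti x)
    (c : Fin N → ℝ) (L : List (Fin N)) (hL : L.Pairwise (· < ·)) (y : Fin (N + 1) → ℕ) :
    L.foldr (fun i g => Aop q (c i) i g) (Hfun q x) y =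
      Hfun q x y * (L.map fun i => ∑ s ∈ Finset.range (y i.succ + 1),
        Cco q (c i) (y i.succ) (s : ℤ) * moveWeight q x i s).prod := by
  induction L generalizing y with
  | nil => simp
  | cons i L ih =>
    obtain ⟨hi, hL⟩ := List.pairwise_cons.1 hL
    rw [List.foldr_cons, Aop, List.map_cons, List.prod_cons, ← mul_assoc, Finset.mul_sum,
      Finset.sum_mul]
    refine Finset.sum_congr rfl fun s hs => ?_
    have hmove : ∀ k ∈ L, moveY y i s k.succ = y k.succ := fun k hk => by
      have hlt := Fin.lt_def.1 (hi k hk)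
      rw [moveY, Function.update_of_ne, Function.update_of_ne]
      · exact fun h => (hi k hk).ne' (Fin.succ_injective _ h)
      · exact fun h => by
          have := congrArg Fin.val h
          simp at this
          omega
    rw [ih hL, Hfun_moveY hq hx y i (Nat.lt_succ_iff.1 (Finset.mem_range.1 hs)),
      List.map_congr_left fun k hk => by rw [hmove k hk]]
    ring

theorem stmt_5 (q : ℝ) (hq : q ∈ Set.Ioo (0:ℝ) 1) (N : ℕ) (hN : 1 ≤ N)
    (a : Fin N → ℝ) (ha : ∀ i, 0 < a i) (α : ℝ) (hα : α ∈ Set.Ioo (0:ℝ) 1)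
    (haα : ∀ i, a i * α < 1)
    (x : Fin N → ℤ) (hx : StrictAnti x) (y : Fin (N + 1) → ℕ) :
    Summable (fun j : Fin N → ℕ =>
        (∏ i : Fin N,
          if (i : ℕ) = 0 then pInf q (a i * α) (j i)
          else pgeo q (a i * α) ((x (predF i) - x i - 1).toNat) (j i : ℤ))
        * Hfun q (fun i => x i + (j i : ℤ)) y) ∧
      (∑' j : Fin N → ℕ,
        (∏ i : Fin N,
          if (i : ℕ) = 0 then pInf q (a i * α) (j i)
          else pgeo q (a i * α) ((x (predF i) - x i - 1).toNat) (j i : ℤ))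
        * Hfun q (fun i => x i + (j i : ℤ)) y)
      = Acomp q (fun i => -(a i * α)) (Hfun q x) y := by
  have hq0 : q ≠ 0 := hq.1.ne'
  have hsite (i : Fin N) : HasSum (fun j : ℕ =>
      (if (i : ℕ) = 0 then pInf q (a i * α) j
        else pgeo q (a i * α) ((x (predF i) - x i - 1).toNat) (j : ℤ)) * (q ^ y i.succ) ^ j)
      (∑ s ∈ Finset.range (y i.succ + 1),
        Cco q (-(a i * α)) (y i.succ) (s : ℤ) * moveWeight q x i s) := by
    simp only [Cco_neg, moveWeight]
    split_ifs with hi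
    · rw [Finset.sum_eq_single 0 (fun s _ hs => by simp [hs]) (by simp), if_pos rfl, mul_one,
        pgeo_zero_right hq]
      exact hasSum_pInf hq (mul_pos (ha i) hα.1) (haα i) _
    · have h := hasSum_pgeo q (a i * α) ((x (predF i) - x i - 1).toNat) (q ^ y i.succ)
      rwa [pgeoGen_symm hq] at h
  have key := (hasSum_prod_fin _ _ hsite).mul_left (Hfun q x y)
  have hsum : HasSum (fun j : Fin N → ℕ =>
      (∏ i : Fin N,
        if (i : ℕ) = 0 then pInf q (a i * α) (j i)
        else pgeo q (a i * α) ((x (predF i) - x i - 1).toNat) (j i : ℤ))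
      * Hfun q (fun i => x i + (j i : ℤ)) y) (Acomp q (fun i => -(a i * α)) (Hfun q x) y) := by
    rw [Acomp, foldr_Aop_Hfun hq0 hx _ _ (List.pairwise_lt_finRange N), ← Fin.prod_univ_def]
    refine key.congr_fun fun j => ?_
    rw [Finset.prod_mul_distrib, mul_left_comm]
    congr 1
    simp only [Hfun]
    split_ifs
    · rw [← Finset.prod_mul_distrib]
      refine Finset.prod_congr rfl fun i _ => ?_
      rw [← pow_mul, ← zpow_natCast, ← zpow_add₀ hq0]
      congr 1
      push_cast
      ring
    · rw [zero_mul]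
  exact ⟨hsum.summable, hsum.tsum_eq⟩
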